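/- Under the standing setup (with α continuously differentiable and α' nondecreasing), let y_ref : [0,∞) → ℝ^m be twice continuously differentiable with bounded second derivative, let f̂ : [0,∞) → ℝ^m satisfy ‖f̂(t)‖ ≤ f_max for all t, and set γ₁(t) := α(‖e₁(t)‖²)e₁(t) and J(t) := (φ'(t)/φ(t))·(e₂(t) − γ₁(t)) + γ₁'(t) + φ(t)·(f̂(t) − y_ref''(t)). If at time t ≥ 0 one has ‖e₁(t)‖ ≤ ε₁ := max{‖e₁(0)‖, ξ} < 1 and ‖e₂(t)‖ ≤ 1, then ‖J(t)‖ ≤ κ₀ := L·(1 + α(ε₁²)ε₁) + Φ∞·(f_max + sup_{s≥0}‖y_ref''(s)‖) + γ̄, where γ̄ := (2α'(ε₁²)ε₁² + α(ε₁²))·(α(ξ²)ξ + α(ε₁²)ε₁) and Φ∞ := sup_{s≥0} φ(s). -/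

import Mathlib

/-- A function that is monotone on an interval `[a, b)` has nonnegative derivative there. -/
theorem MonotoneOn.hasDerivAt_nonneg_Ico {f : ℝ → ℝ} {a b x f' : ℝ}
    (hf : MonotoneOn f (Set.Ico a b)) (hx : x ∈ Set.Ico a b) (h : HasDerivAt f f' x) :
    0 ≤ f' := by
  rw [← h.hasDerivWithinAt.derivWithin (uniqueDiffOn_Ico a b x hx)]
  exact hf.derivWithin_nonneg

/-- Norm bound for the derivative `a • w + (b * (2 * ⟪v, w⟫)) • v` of `α (‖v‖ ^ 2) • v` in
direction `w`. -/
theorem norm_radial_deriv_le {E : Type*} [NormedAddCommGroup E] [InnerProductSpace ℝ E]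
    {a b A B r W : ℝ} {v w : E} (ha : 0 ≤ a) (hb : 0 ≤ b) (haA : a ≤ A) (hbB : b ≤ B)
    (hv : ‖v‖ ≤ r) (hw : ‖w‖ ≤ W) :
    ‖a • w + (b * (2 * inner ℝ v w)) • v‖ ≤ (2 * B * r ^ 2 + A) * W := by
  have hA : 0 ≤ A := ha.trans haA
  have hB : 0 ≤ B := hb.trans hbB
  have hW : 0 ≤ W := (norm_nonneg w).trans hw
  have hr : 0 ≤ r := (norm_nonneg v).trans hv
  calc ‖a • w + (b * (2 * inner ℝ v w)) • v‖
      ≤ ‖a • w‖ + ‖(b * (2 * inner ℝ v w)) • v‖ := norm_add_le _ _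
    _ = a * ‖w‖ + b * (2 * |inner ℝ v w|) * ‖v‖ := by
      simp [norm_smul, abs_of_nonneg ha, abs_of_nonneg hb]
    _ ≤ a * ‖w‖ + b * (2 * (‖v‖ * ‖w‖)) * ‖v‖ := by
      gcongr
      exact abs_real_inner_le_norm v w
    _ ≤ A * W + B * (2 * (r * W)) * r := by gcongr
    _ = (2 * B * r ^ 2 + A) * W := by ring


/-- Bound `‖J(t)‖ ≤ κ₀` on the drift term of identity (A.1) of the paper's
appendix, with the constant `κ₀` from equation (11):
`J(t) = (φ'(t)/φ(t))(e₂(t) − γ₁(t)) + γ₁'(t) + φ(t)(f̂(t) − y_ref''(t))`, where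
`γ₁(t) = α(‖e₁(t)‖²)e₁(t)`. -/
theorem J_bound {m : ℕ} (hm : 1 ≤ m)
    (φ φ' : ℝ → ℝ) (φmin Φ L : ℝ)
    (hφd : ∀ s ∈ Set.Ici (0:ℝ), HasDerivAt φ (φ' s) s)
    (hφ'c : ContinuousOn φ' (Set.Ici (0:ℝ)))
    (hφmin0 : 0 < φmin) (hφmin : ∀ s ∈ Set.Ici (0:ℝ), φmin ≤ φ s)
    (hΦ : ∀ s ∈ Set.Ici (0:ℝ), φ s ≤ Φ)
    (hL : ∀ s ∈ Set.Ici (0:ℝ), |φ' s| ≤ L * φ s)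
    (α α' : ℝ → ℝ)
    (hαmono : StrictMonoOn α (Set.Ico (0:ℝ) 1))
    (hαbij : Set.BijOn α (Set.Ico (0:ℝ) 1) (Set.Ici (1:ℝ)))
    (hαd : ∀ s ∈ Set.Ico (0:ℝ) 1, HasDerivAt α (α' s) s)
    (hα'c : ContinuousOn α' (Set.Ico (0:ℝ) 1))
    (hα'mono : MonotoneOn α' (Set.Ico (0:ℝ) 1))
    (e e' : ℝ → EuclideanSpace ℝ (Fin m))
    (he : ∀ s ∈ Set.Ici (0:ℝ), HasDerivAt e (e' s) s)
    (he'c : ContinuousOn e' (Set.Ici (0:ℝ)))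
    (ξ : ℝ) (hξ : ξ ∈ Set.Ioo (0:ℝ) 1) (hξeq : α (ξ ^ 2) * ξ = 1 + L)
    (yref yref' yref'' : ℝ → EuclideanSpace ℝ (Fin m)) (r₂ : ℝ)
    (hyref : ∀ s ∈ Set.Ici (0:ℝ), HasDerivAt yref (yref' s) s)
    (hyref' : ∀ s ∈ Set.Ici (0:ℝ), HasDerivAt yref' (yref'' s) s)
    (hyref''c : ContinuousOn yref'' (Set.Ici (0:ℝ)))
    (hr₂ : ∀ s ∈ Set.Ici (0:ℝ), ‖yref'' s‖ ≤ r₂)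
    (fhat : ℝ → EuclideanSpace ℝ (Fin m)) (fmax : ℝ)
    (hfhat : ∀ s ∈ Set.Ici (0:ℝ), ‖fhat s‖ ≤ fmax)
    (ε₁ γbar κ₀ : ℝ) (hε₁ : ε₁ = max ‖φ 0 • e 0‖ ξ) (hε₁lt : ε₁ < 1)
    (hγbar : γbar = (2 * α' (ε₁ ^ 2) * ε₁ ^ 2 + α (ε₁ ^ 2)) *
      (α (ξ ^ 2) * ξ + α (ε₁ ^ 2) * ε₁))
    (hκ₀ : κ₀ = L * (1 + α (ε₁ ^ 2) * ε₁) + Φ * (fmax + r₂) + γbar)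
    (t : ℝ) (ht : 0 ≤ t)
    (h1 : ‖φ t • e t‖ ≤ ε₁)
    (h2 : ‖φ t • e' t + α (‖φ t • e t‖ ^ 2) • (φ t • e t)‖ ≤ 1) :
    ∀ D : EuclideanSpace ℝ (Fin m),
      HasDerivAt (fun s => α (‖φ s • e s‖ ^ 2) • (φ s • e s)) D t →
      ‖(φ' t / φ t) •
          ((φ t • e' t + α (‖φ t • e t‖ ^ 2) • (φ t • e t)) -
            α (‖φ t • e t‖ ^ 2) • (φ t • e t)) +
        D + φ t • (fhat t - yref'' t)‖ ≤ κ₀ := by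
  intro D hD
  have hφt : 0 < φ t := hφmin0.trans_le (hφmin t ht)
  have hquot : |φ' t / φ t| ≤ L := by
    rw [abs_div, abs_of_pos hφt, div_le_iff₀ hφt]
    exact hL t ht
  have hL0 : 0 ≤ L := (abs_nonneg _).trans hquot
  have hderiv₁ : HasDerivAt (fun s => φ s • e s) (φ t • e' t + φ' t • e t) t :=
    (hφd t ht).smul (he t ht)
  have hderiv_eq : φ t • e' t + φ' t • e t = (φ' t / φ t) • (φ t • e t) + φ t • e' t := by
    rw [smul_smul, div_mul_cancel₀ _ hφt.ne', add_comm]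
  set v : EuclideanSpace ℝ (Fin m) := φ t • e t with hv
  have hε₁0 : 0 ≤ ε₁ := (norm_nonneg v).trans h1
  have hsq_le : ‖v‖ ^ 2 ≤ ε₁ ^ 2 := by gcongr
  have hε₁mem : ε₁ ^ 2 ∈ Set.Ico (0:ℝ) 1 :=
    ⟨sq_nonneg _, pow_lt_one₀ hε₁0 hε₁lt two_ne_zero⟩
  have hvmem : ‖v‖ ^ 2 ∈ Set.Ico (0:ℝ) 1 := ⟨sq_nonneg _, hsq_le.trans_lt hε₁mem.2⟩
  have hα0 : 0 ≤ α (‖v‖ ^ 2) := zero_le_one.trans (hαbij.mapsTo hvmem)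
  have hα_le : α (‖v‖ ^ 2) ≤ α (ε₁ ^ 2) := hαmono.monotoneOn hvmem hε₁mem hsq_le
  have hα'0 : 0 ≤ α' (‖v‖ ^ 2) :=
    hαmono.monotoneOn.hasDerivAt_nonneg_Ico hvmem (hαd _ hvmem)
  have hα'_le : α' (‖v‖ ^ 2) ≤ α' (ε₁ ^ 2) := hα'mono hvmem hε₁mem hsq_le
  have hγ : ‖α (‖v‖ ^ 2) • v‖ ≤ α (ε₁ ^ 2) * ε₁ := by
    rw [norm_smul, Real.norm_of_nonneg hα0]
    exact mul_le_mul hα_le h1 (norm_nonneg _) (hα0.trans hα_le)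
  have he' : ‖φ t • e' t‖ ≤ 1 + α (ε₁ ^ 2) * ε₁ := by
    have h := norm_sub_le (φ t • e' t + α (‖v‖ ^ 2) • v) (α (‖v‖ ^ 2) • v)
    rw [add_sub_cancel_right] at h
    linarith
  have hdrift : ∀ u : EuclideanSpace ℝ (Fin m), ‖(φ' t / φ t) • u‖ ≤ L * ‖u‖ := fun u => by
    rw [norm_smul, Real.norm_eq_abs]
    gcongr
  have hw : ‖φ t • e' t + φ' t • e t‖ ≤ α (ξ ^ 2) * ξ + α (ε₁ ^ 2) * ε₁ := by
    rw [hderiv_eq, hξeq]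
    have h := norm_add_le ((φ' t / φ t) • v) (φ t • e' t)
    have hLv : L * ‖v‖ ≤ L * 1 := by
      gcongr
      exact h1.trans hε₁lt.le
    linarith [hdrift v]
  have hDeq : D = α (‖v‖ ^ 2) • (φ t • e' t + φ' t • e t) +
      (α' (‖v‖ ^ 2) * (2 * inner ℝ v (φ t • e' t + φ' t • e t))) • v :=
    hD.unique (((hαd _ hvmem).comp t hderiv₁.norm_sq).smul hderiv₁)
  have hDle : ‖D‖ ≤ γbar := by
    rw [hDeq, hγbar]
    exact norm_radial_deriv_le hα0 hα'0 hα_le hα'_le h1 hw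
  have hforce : ‖φ t • (fhat t - yref'' t)‖ ≤ Φ * (fmax + r₂) := by
    rw [norm_smul, Real.norm_of_nonneg hφt.le]
    exact mul_le_mul (hΦ t ht)
      ((norm_sub_le _ _).trans (add_le_add (hfhat t ht) (hr₂ t ht))) (norm_nonneg _)
      (hφt.le.trans (hΦ t ht))
  rw [add_sub_cancel_right, hκ₀]
  have hfirst : ‖(φ' t / φ t) • (φ t • e' t)‖ ≤ L * (1 + α (ε₁ ^ 2) * ε₁) :=
    (hdrift _).trans (by gcongr)
  linarith [norm_add₃_le (a := (φ' t / φ t) • (φ t • e' t)) (b := D)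
    (c := φ t • (fhat t - yref'' t))]
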